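/- The equivalence relation σ ∼ τ ⟺ GC(σ) = GC(τ) on permutations is compatible with shifted shuffle: if σ ∼ σ' in S_m and τ ∼ τ' in S_n, then the multisets {GC(μ) : μ ∈ σ ⋒ τ} and {GC(μ) : μ ∈ σ' ⋒ τ'} of compositions of m+n coincide. -/

import Mathlib

/-- Descent set of a composition `I` (list of parts): partial sums except the total. -/
def descSetC (I : List ℕ) : Finset ℕ :=
  ((I.scanl (· + ·) 0).tail.dropLast).toFinset

/-- `I` is a composition of `n`: positive parts summing to `n`. -/
def IsComp (n : ℕ) (I : List ℕ) : Prop :=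
  (∀ i ∈ I, 0 < i) ∧ I.sum = n

/-- The composition of `n` whose descent set is `D ⊆ {1,…,n-1}`. -/
def compOfDescSet (n : ℕ) (D : Finset ℕ) : List ℕ :=
  let s := (D.sort (· ≤ ·)) ++ [n]
  (List.zipWith (fun a b => a - b) s (0 :: s)).filter (fun x => 0 < x)
/-- Genocchi descent set of a word in one-line notation: the set of values
immediately followed by a smaller value. -/
def GDes (l : List ℕ) : Finset ℕ :=
  ((Finset.range l.length).filter
    (fun j => j + 1 < l.length ∧ l.getD (j+1) 0 < l.getD j 0)).image (fun j => l.getD j 0)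

/-- Genocchi composition of a permutation of `{1,…,n}`: the composition of `n`
whose descent set is `{d - 1 : d ∈ GDes}`. -/
def GComp (n : ℕ) (l : List ℕ) : List ℕ :=
  compOfDescSet n ((GDes l).image (· - 1))
/-- All shuffles of two words (as a list with multiplicities). -/
def shuffles : List ℕ → List ℕ → List (List ℕ)
  | [], v => [v]
  | u, [] => [u]
  | a :: u, b :: v =>
      (shuffles u (b :: v)).map (a :: ·) ++ (shuffles (a :: u) v).map (b :: ·)
  termination_by u v => u.length + v.length

/-- Shifted shuffle of `σ ∈ S_m` with `τ ∈ S_n`: shuffles of `σ` with `τ[m]`. -/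
def shiftShuffle (m : ℕ) (σ τ : List ℕ) : List (List ℕ) :=
  shuffles σ (τ.map (· + m))

theorem mem_GDes {l : List ℕ} {x : ℕ} :
    x ∈ GDes l ↔ ∃ j, j + 1 < l.length ∧ l.getD (j + 1) 0 < l.getD j 0 ∧ l.getD j 0 = x := by
  simp only [GDes, Finset.mem_image, Finset.mem_filter, Finset.mem_range]
  constructor
  · rintro ⟨j, ⟨-, h1, h2⟩, h3⟩
    exact ⟨j, h1, h2, h3⟩
  · rintro ⟨j, h1, h2, h3⟩
    exact ⟨j, ⟨by omega, h1, h2⟩, h3⟩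

@[simp] theorem GDes_nil : GDes [] = ∅ := rfl

@[simp] theorem GDes_singleton (a : ℕ) : GDes [a] = ∅ := by
  ext x
  simp [mem_GDes]

theorem GDes_cons_cons (a b : ℕ) (l : List ℕ) :
    GDes (a :: b :: l) = (if b < a then {a} else ∅) ∪ GDes (b :: l) := by
  ext x
  rw [Finset.mem_union, mem_GDes, mem_GDes]
  constructor
  · rintro ⟨_ | j, h1, h2, h3⟩
    · left
      simp at h2 h3
      subst h3
      simp [h2]
    · right
      exact ⟨j, by simpa using h1, by simpa using h2, by simpa using h3⟩
  · rintro (h | ⟨j, h1, h2, h3⟩)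
    · split_ifs at h with hba
      · exact ⟨0, by simp, by simpa using hba, by simpa using (Finset.mem_singleton.1 h).symm⟩
      · simp at h
    · exact ⟨j + 1, by simpa using h1, by simpa using h2, by simpa using h3⟩

theorem mem_of_mem_GDes {l : List ℕ} {x : ℕ} (h : x ∈ GDes l) : x ∈ l := by
  obtain ⟨j, h1, -, rfl⟩ := mem_GDes.1 h
  rw [List.getD_eq_getElem _ _ (by omega)]
  exact List.getElem_mem _

theorem exists_lt_of_mem_GDes {l : List ℕ} {x : ℕ} (h : x ∈ GDes l) : ∃ y ∈ l, y < x := by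
  obtain ⟨j, h1, h2, rfl⟩ := mem_GDes.1 h
  refine ⟨_, ?_, h2⟩
  rw [List.getD_eq_getElem _ _ h1]
  exact List.getElem_mem _

theorem GDes_map_add (m : ℕ) (l : List ℕ) :
    GDes (l.map (· + m)) = (GDes l).image (· + m) := by
  induction l with
  | nil => rfl
  | cons a l ih =>
    cases l with
    | nil => simp
    | cons b l =>
      simp only [List.map_cons] at ih ⊢
      rw [GDes_cons_cons, ih, GDes_cons_cons, Finset.image_union]
      congr 1
      split_ifs <;> first | omega | simp

/-- The unions of `e` with `k` members of the multiset `M` of sets. -/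
def unionsCard (k : ℕ) (M : Multiset (Finset ℕ)) (e : Finset ℕ) : Multiset (Finset ℕ) :=
  (Multiset.powersetCard k M).map fun X => e ∪ X.sup

theorem unionsCard_zero (M : Multiset (Finset ℕ)) (e : Finset ℕ) : unionsCard 0 M e = {e} := by
  simp [unionsCard]

theorem unionsCard_succ_cons (k : ℕ) (s : Finset ℕ) (M : Multiset (Finset ℕ)) (e : Finset ℕ) :
    unionsCard (k + 1) (s ::ₘ M) e = unionsCard (k + 1) M e + unionsCard k M (s ∪ e) := by
  simp only [unionsCard, Multiset.powersetCard_cons, Multiset.map_add, Multiset.map_map]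
  congr 1
  refine Multiset.map_congr rfl fun X _ => ?_
  simp only [Function.comp_apply, Multiset.sup_cons, Finset.sup_eq_union]
  ext x
  simp only [Finset.mem_union]
  tauto

theorem unionsCard_union (k : ℕ) (M : Multiset (Finset ℕ)) (s e : Finset ℕ) :
    unionsCard k M (s ∪ e) = (unionsCard k M e).map (s ∪ ·) := by
  simp only [unionsCard, Multiset.map_map, Function.comp_def, Finset.union_assoc]

theorem unionsCard_of_card_lt {k : ℕ} {M : Multiset (Finset ℕ)} (e : Finset ℕ)
    (h : M.card < k) : unionsCard k M e = 0 := by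
  simp [unionsCard, Multiset.powersetCard_eq_empty, h]

/-- For each letter of `a :: u` but the last: the singleton of that letter if it is followed by a
smaller one, the empty set otherwise. -/
def descentTags : ℕ → List ℕ → List (Finset ℕ)
  | _, [] => []
  | a, c :: u => (if c < a then {a} else ∅) :: descentTags c u

@[simp] theorem length_descentTags (a : ℕ) (u : List ℕ) :
    (descentTags a u).length = u.length := by
  induction u generalizing a with
  | nil => rfl
  | cons c u ih => simp [descentTags, ih]

/-- The multiset of all singletons of letters of `v` together with the descent tags of `a :: u`. -/
def shuffleTags (a : ℕ) (u v : List ℕ) : Multiset (Finset ℕ) :=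
  (descentTags a u : Multiset (Finset ℕ)) + (v.map fun x => ({x} : Finset ℕ))

theorem shuffleTags_cons_left (a c : ℕ) (u v : List ℕ) :
    shuffleTags a (c :: u) v = (if c < a then {a} else ∅) ::ₘ shuffleTags c u v := by
  simp only [shuffleTags, descentTags, ← Multiset.cons_coe, Multiset.cons_add]

theorem shuffleTags_cons_right (a b : ℕ) (u v : List ℕ) :
    shuffleTags a u (b :: v) = {b} ::ₘ shuffleTags a u v := by
  simp only [shuffleTags, List.map_cons, ← Multiset.cons_coe, Multiset.add_cons]

theorem card_shuffleTags_nil (a : ℕ) (u : List ℕ) : (shuffleTags a u []).card = u.length := by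
  simp [shuffleTags]

/-- Distribution of `GDes` over the words `x :: w` for `w` a shuffle of `u` and `v`. -/
def consShuffleGDes (x : ℕ) (u v : List ℕ) : Multiset (Finset ℕ) :=
  ((shuffles u v).map fun w => GDes (x :: w) : List (Finset ℕ))

theorem shuffles_nil_right (u : List ℕ) : shuffles u [] = [u] := by
  cases u <;> simp [shuffles]

theorem shuffles_nil_left (v : List ℕ) : shuffles [] v = [v] := by
  simp [shuffles]

theorem consShuffleGDes_cons_cons (x a b : ℕ) (u v : List ℕ) :
    consShuffleGDes x (a :: u) (b :: v) =
      (consShuffleGDes a u (b :: v)).map ((if a < x then {x} else ∅) ∪ ·) +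
      (consShuffleGDes b (a :: u) v).map ((if b < x then {x} else ∅) ∪ ·) := by
  simp only [consShuffleGDes, shuffles, List.map_append, List.map_map, Multiset.map_coe,
    ← Multiset.coe_add, Function.comp_def, GDes_cons_cons]

theorem consShuffleGDes_nil_left (x : ℕ) (v : List ℕ) :
    consShuffleGDes x [] v = {GDes (x :: v)} := by
  simp [consShuffleGDes, shuffles_nil_left]

theorem consShuffleGDes_nil_right (x : ℕ) (u : List ℕ) :
    consShuffleGDes x u [] = {GDes (x :: u)} := by
  simp [consShuffleGDes, shuffles_nil_right]

theorem unionsCard_shuffleTags_nil (a : ℕ) (u : List ℕ) :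
    unionsCard u.length (shuffleTags a u []) ∅ = {GDes (a :: u)} := by
  induction u generalizing a with
  | nil => simp [unionsCard_zero]
  | cons c u ih =>
    rw [shuffleTags_cons_left, List.length_cons, unionsCard_succ_cons,
      unionsCard_of_card_lt _ (by simp [card_shuffleTags_nil]), unionsCard_union, ih,
      GDes_cons_cons]
    simp

theorem consShuffleGDes_eq (N : ℕ) :
    (∀ a u v, u.length + v.length ≤ N → (∀ x ∈ a :: u, ∀ y ∈ v, x < y) →
      consShuffleGDes a u v = unionsCard u.length (shuffleTags a u v) (GDes v)) ∧
    (∀ b c u v, u.length + v.length + 1 ≤ N → (∀ x ∈ c :: u, ∀ y ∈ b :: v, x < y) →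
      consShuffleGDes b (c :: u) v =
        unionsCard (u.length + 1) (shuffleTags c u (b :: v)) (GDes (b :: v))) := by
  induction N with
  | zero =>
    refine ⟨fun a u v h hlt => ?_, fun b c u v h => by omega⟩
    obtain rfl : u = [] := List.length_eq_zero_iff.1 (by omega)
    obtain rfl : v = [] := List.length_eq_zero_iff.1 (by omega)
    simp [consShuffleGDes_nil_left, unionsCard_zero]
  | succ N ih =>
    obtain ⟨ihP, ihQ⟩ := ih
    constructor
    · intro a u v h hlt
      cases u with
      | nil =>
        rw [consShuffleGDes_nil_left, List.length_nil, unionsCard_zero]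
        cases v with
        | nil => simp
        | cons b v =>
          have : a < b := hlt a (by simp) b (by simp)
          rw [GDes_cons_cons, if_neg (by omega), Finset.empty_union]
      | cons c u =>
        cases v with
        | nil =>
          rw [consShuffleGDes_nil_right, GDes_nil, unionsCard_shuffleTags_nil]
        | cons b v =>
          have hab : a < b := hlt a (by simp) b (by simp)
          simp only [List.length_cons] at h
          rw [consShuffleGDes_cons_cons, shuffleTags_cons_left, List.length_cons,
            unionsCard_succ_cons, unionsCard_union,
            ihP c u (b :: v) (by simp; omega) fun x hx => hlt x (by simp_all),
            ihQ b c u v (by omega) fun x hx => hlt x (by simp_all), if_neg (by omega : ¬ b < a)]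
          simp [add_comm]
    · intro b c u v h hlt
      have hcb : c < b := hlt c (by simp) b (by simp)
      rw [shuffleTags_cons_right, unionsCard_succ_cons]
      cases v with
      | nil =>
        rw [consShuffleGDes_nil_right, unionsCard_of_card_lt _ (by simp [card_shuffleTags_nil]),
          GDes_singleton, unionsCard_union, unionsCard_shuffleTags_nil, GDes_cons_cons]
        simp [hcb]
      | cons d v =>
        simp only [List.length_cons] at h
        have hE : {b} ∪ GDes (b :: d :: v) = {b} ∪ GDes (d :: v) := by
          rw [GDes_cons_cons]
          split_ifs <;> simp
        rw [hE, GDes_cons_cons, consShuffleGDes_cons_cons,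
            ihP c u (d :: v) (by simp; omega) fun x hx y hy => hlt x hx y (by simp_all),
            ihQ d c u v (by omega) fun x hx y hy => hlt x hx y (by simp_all), if_pos hcb,
            unionsCard_union, unionsCard_union, add_comm]

theorem map_ite_mem_GDes (a : ℕ) (u : List ℕ) (h : (a :: u).Nodup) :
    (a :: u).map (fun x => if x ∈ GDes (a :: u) then ({x} : Finset ℕ) else ∅) =
      descentTags a u ++ [∅] := by
  induction u generalizing a with
  | nil => simp [descentTags]
  | cons c u ih =>
    have ha : a ∉ c :: u := (List.nodup_cons.1 h).1
    have ha' : a ∉ GDes (c :: u) := fun h => ha (mem_of_mem_GDes h)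
    rw [List.map_cons, descentTags, List.cons_append, ← ih c (List.nodup_cons.1 h).2]
    congr 1
    · rw [GDes_cons_cons]
      split_ifs <;> simp_all
    · refine List.map_congr_left fun x hx => ?_
      have hxa : x ≠ a := fun e => ha (e ▸ hx)
      rw [GDes_cons_cons]
      split_ifs <;> simp_all

/-- The distribution of `GDes` over the shuffles of two words, the letters of the first being
smaller than those of the second. -/
theorem map_GDes_shuffles (u v : List ℕ) (hu : u.Nodup) (hlt : ∀ x ∈ u, ∀ y ∈ v, x < y) :
    (((shuffles u v).map GDes : List (Finset ℕ)) : Multiset (Finset ℕ)) =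
      unionsCard u.length
        (((u : Multiset ℕ).map fun x => if x ∈ GDes u then ({x} : Finset ℕ) else ∅) +
          (v : Multiset ℕ).map fun x => ({x} : Finset ℕ)) (GDes v) := by
  cases u with
  | nil => simp [shuffles_nil_left, unionsCard_zero]
  | cons a u =>
    have htags : (((a :: u : List ℕ) : Multiset ℕ).map
          fun x => if x ∈ GDes (a :: u) then ({x} : Finset ℕ) else ∅) +
          (v : Multiset ℕ).map (fun x => ({x} : Finset ℕ)) = ∅ ::ₘ shuffleTags a u v := by
      rw [Multiset.map_coe, map_ite_mem_GDes a u hu, ← Multiset.coe_add, Multiset.map_coe,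
        shuffleTags, ← Multiset.cons_add, Multiset.coe_singleton, add_comm _ {∅},
        Multiset.singleton_add]
    rw [htags, List.length_cons, unionsCard_succ_cons, Finset.empty_union]
    cases v with
    | nil =>
      rw [shuffles_nil_right, unionsCard_of_card_lt _ (by simp [card_shuffleTags_nil]), GDes_nil,
        unionsCard_shuffleTags_nil]
      simp
    | cons b v =>
      have hP := (consShuffleGDes_eq (u.length + v.length + 1)).1 a u (b :: v) (by simp; omega) hlt
      have hQ := (consShuffleGDes_eq (u.length + v.length + 1)).2 b a u v le_rfl hlt
      rw [← hP, ← hQ, add_comm]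
      simp only [shuffles, List.map_append, List.map_map, consShuffleGDes, Multiset.coe_add,
        Function.comp_def]

theorem consecutive_differences_injective (x : ℕ) (s t : List ℕ)
    (hs : (x :: s).Pairwise (· < ·)) (ht : (x :: t).Pairwise (· < ·))
    (h : (List.zipWith (fun a b => a - b) s (x :: s)).filter (fun y => 0 < y) =
      (List.zipWith (fun a b => a - b) t (x :: t)).filter (fun y => 0 < y)) : s = t := by
  induction s generalizing x t with
  | nil =>
    cases t with
    | nil => rfl
    | cons z t =>
      have hz : x < z := by simp_all
      simp [hz] at h
  | cons y s ih =>
    have hy : x < y := by simp_all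
    cases t with
    | nil => simp [hy] at h
    | cons z t =>
      have hz : x < z := by simp_all
      simp only [List.zipWith_cons_cons] at h
      rw [List.filter_cons_of_pos (by simpa using hy), List.filter_cons_of_pos (by simpa using hz),
        List.cons.injEq] at h
      obtain rfl : y = z := by omega
      rw [ih y t hs.of_cons ht.of_cons h.2]

theorem compOfDescSet_injective {n : ℕ} {D D' : Finset ℕ} (hD : ∀ d ∈ D, 0 < d ∧ d < n)
    (hD' : ∀ d ∈ D', 0 < d ∧ d < n) (hn : 0 < n)
    (h : compOfDescSet n D = compOfDescSet n D') : D = D' := by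
  have key : ∀ D : Finset ℕ, (∀ d ∈ D, 0 < d ∧ d < n) →
      (0 :: (D.sort (· ≤ ·) ++ [n])).Pairwise (· < ·) := by
    intro D hD
    rw [List.pairwise_cons, List.pairwise_append]
    refine ⟨?_, (Finset.sortedLT_sort D).pairwise, by simp, ?_⟩
    · intro d hd
      rcases List.mem_append.1 hd with hd | hd
      · exact (hD d (by simpa using hd)).1
      · simp_all
    · intro d hd y hy
      obtain rfl : y = n := by simpa using hy
      exact (hD d (by simpa using hd)).2
  have hs := List.append_cancel_right
    (consecutive_differences_injective 0 _ _ (key D hD) (key D' hD') h)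
  rw [← Finset.sort_toFinset D (· ≤ ·), hs, Finset.sort_toFinset]

theorem GDes_eq_of_GComp_eq {m : ℕ} {σ σ' : List ℕ} (hσ : σ.Perm (List.range' 1 m))
    (hσ' : σ'.Perm (List.range' 1 m)) (h : GComp m σ = GComp m σ') : GDes σ = GDes σ' := by
  have bounds : ∀ τ : List ℕ, τ.Perm (List.range' 1 m) → ∀ d ∈ GDes τ, 2 ≤ d ∧ d ≤ m := by
    intro τ hτ d hd
    obtain ⟨y, hy, hyd⟩ := exists_lt_of_mem_GDes hd
    have h1 := hτ.mem_iff.1 hy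
    have h2 := hτ.mem_iff.1 (mem_of_mem_GDes hd)
    simp only [List.mem_range'_1] at h1 h2
    omega
  rcases Nat.eq_zero_or_pos m with rfl | hm
  · simp_all
  have himage : (GDes σ).image (· - 1) = (GDes σ').image (· - 1) := by
    refine compOfDescSet_injective ?_ ?_ hm h <;>
    · simp only [Finset.mem_image]
      rintro _ ⟨d, hd, rfl⟩
      have := bounds _ (by assumption) d hd
      omega
  have key : ∀ τ : List ℕ, τ.Perm (List.range' 1 m) →
      ((GDes τ).image (· - 1)).image (· + 1) = GDes τ := by
    intro τ hτ
    rw [Finset.image_image]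
    conv_rhs => rw [← Finset.image_id (s := GDes τ)]
    refine Finset.image_congr fun d hd => ?_
    have := bounds τ hτ d hd
    simp only [Function.comp_apply, id]
    omega
  rw [← key σ hσ, himage, key σ' hσ']

theorem map_GDes_shiftShuffle (m n : ℕ) (σ τ : List ℕ) (hσ : σ.Perm (List.range' 1 m))
    (hτ : τ.Perm (List.range' 1 n)) :
    (((shiftShuffle m σ τ).map GDes : List (Finset ℕ)) : Multiset (Finset ℕ)) =
      unionsCard m
        (((List.range' 1 m : Multiset ℕ).map fun x => if x ∈ GDes σ then {x} else ∅) +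
          (List.range' 1 n : Multiset ℕ).map fun x => {x + m}) ((GDes τ).image (· + m)) := by
  have hlt : ∀ x ∈ σ, ∀ y ∈ τ.map (· + m), x < y := by
    intro x hx y hy
    obtain ⟨z, hz, rfl⟩ := List.mem_map.1 hy
    have h1 := hσ.mem_iff.1 hx
    have h2 := hτ.mem_iff.1 hz
    simp only [List.mem_range'_1] at h1 h2
    omega
  rw [shiftShuffle, map_GDes_shuffles _ _ (hσ.nodup_iff.2 (List.nodup_range' ..)) hlt,
    GDes_map_add, ← Multiset.map_coe, Multiset.map_map, Multiset.coe_eq_coe.2 hσ,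
    Multiset.coe_eq_coe.2 hτ, hσ.length_eq, List.length_range']
  rfl

/-- The equivalence `σ ∼ τ ⟺ GC(σ) = GC(τ)` is compatible with the shifted
shuffle: the multiset of G-compositions of the shifted shuffle of two
permutations depends only on the G-compositions of the factors. -/
theorem stmt6 (m n : ℕ) (σ σ' τ τ' : List ℕ)
    (hσ : σ.Perm (List.range' 1 m)) (hσ' : σ'.Perm (List.range' 1 m))
    (hτ : τ.Perm (List.range' 1 n)) (hτ' : τ'.Perm (List.range' 1 n))
    (h1 : GComp m σ = GComp m σ') (h2 : GComp n τ = GComp n τ') :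
    (↑((shiftShuffle m σ τ).map (GComp (m + n))) : Multiset (List ℕ))
      = ↑((shiftShuffle m σ' τ').map (GComp (m + n))) := by
  have key : ∀ L : List (List ℕ), ((L.map (GComp (m + n)) : List (List ℕ)) : Multiset (List ℕ)) =
      ((L.map GDes : List (Finset ℕ)) : Multiset (Finset ℕ)).map
        fun D => compOfDescSet (m + n) (D.image (· - 1)) := by
    intro L
    rw [Multiset.map_coe, List.map_map]
    rfl
  rw [key, key, map_GDes_shiftShuffle m n σ τ hσ hτ, map_GDes_shiftShuffle m n σ' τ' hσ' hτ',
    GDes_eq_of_GComp_eq hσ hσ' h1, GDes_eq_of_GComp_eq hτ hτ' h2]
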